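/- Let ν2(n) denote the number of partitions of n into exactly two part sizes. Then ν2(16n+14) ≡ 0 (mod 4) for all n ≥ 0. -/

import Mathlib

/-- `ν₂ n` counts the partitions of `n` into exactly two part sizes, i.e. quadruples
`(λ1, m1, λ2, m2)` with `λ1 > λ2 ≥ 1`, `m1, m2 ≥ 1`, `λ1 m1 + λ2 m2 = n`. -/
noncomputable def nu2 (n : ℕ) : ℕ :=
  Set.ncard {q : ℕ × ℕ × ℕ × ℕ |
    q.2.2.1 < q.1 ∧ 1 ≤ q.2.2.1 ∧ 1 ≤ q.2.1 ∧ 1 ≤ q.2.2.2 ∧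
    q.1 * q.2.1 + q.2.2.1 * q.2.2.2 = n}

open Finset

theorem card_mod_two_eq_card_fixed {α : Type*} [DecidableEq α] (s : Finset α) (f : α → α)
    (hf : ∀ a ∈ s, f a ∈ s) (hff : ∀ a ∈ s, f (f a) = a) :
    #s % 2 = #{a ∈ s | f a = a} % 2 := by
  have h : ((#{a ∈ s | ¬ f a = a} : ℕ) : ZMod 2) = 0 := by
    rw [card_eq_sum_ones, Nat.cast_sum]
    refine sum_involution (fun a _ ↦ f a) ?_ ?_ ?_ ?_
    · intros; decide
    · intro a ha _
      exact (mem_filter.1 ha).2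
    · intro a ha
      obtain ⟨h1, h2⟩ := mem_filter.1 ha
      refine mem_filter.2 ⟨hf a h1, ?_⟩
      rw [hff a h1]
      exact fun h ↦ h2 h.symm
    · intro a ha
      exact hff a (mem_filter.1 ha).1
  rw [ZMod.natCast_eq_zero_iff] at h
  have := card_filter_add_card_filter_not (s := s) (fun a ↦ f a = a)
  omega

theorem card_divisors_eq_two_mul {u : ℕ} (hu : ¬ IsSquare u) :
    #u.divisors = 2 * #{d ∈ u.divisors | d * d < u} := by
  have h0 : u ≠ 0 := by rintro rfl; exact hu (IsSquare.zero)
  have hbij : #{d ∈ u.divisors | d * d < u} = #{d ∈ u.divisors | ¬ d * d < u} := by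
    refine card_nbij' (fun d ↦ u / d) (fun d ↦ u / d) ?_ ?_ ?_ ?_
    · intro d hd
      simp only [coe_filter, Nat.mem_divisors, Set.mem_ofPred_eq] at hd ⊢
      obtain ⟨⟨⟨e, rfl⟩, _⟩, hlt⟩ := hd
      have hd0 : 0 < d := Nat.pos_of_ne_zero (by rintro rfl; simp at h0)
      rw [Nat.mul_div_cancel_left _ hd0]
      refine ⟨⟨Dvd.intro_left d rfl, h0⟩, ?_⟩
      have := Nat.lt_of_mul_lt_mul_left hlt
      nlinarith
    · intro d hd
      simp only [coe_filter, Nat.mem_divisors, Set.mem_ofPred_eq] at hd ⊢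
      obtain ⟨⟨⟨e, rfl⟩, _⟩, hlt⟩ := hd
      have hd0 : 0 < d := Nat.pos_of_ne_zero (by rintro rfl; simp at h0)
      have he0 : 0 < e := Nat.pos_of_ne_zero (by rintro rfl; simp at h0)
      rw [Nat.mul_div_cancel_left _ hd0]
      refine ⟨⟨Dvd.intro_left d rfl, h0⟩, ?_⟩
      have h1 : d ≠ e := by rintro rfl; exact hu ⟨d, rfl⟩
      have h2 : e ≤ d := Nat.le_of_mul_le_mul_left (not_lt.1 hlt) hd0
      have : e < d := by omega
      nlinarith
    all_goals
      intro d hd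
      simp only [coe_filter, Nat.mem_divisors, Set.mem_ofPred_eq] at hd
      exact Nat.div_div_self hd.1.1 h0
  have := card_filter_add_card_filter_not (s := u.divisors) (fun d ↦ d * d < u)
  omega

/-- Zagier's involution on the solutions of `x ^ 2 + 4 * y * z = u`. -/
def zagier (t : ℕ × ℕ × ℕ) : ℕ × ℕ × ℕ :=
  if t.1 + t.2.2 < t.2.1 then (t.1 + 2 * t.2.2, t.2.2, t.2.1 - t.1 - t.2.2)
  else if t.1 < 2 * t.2.1 then (2 * t.2.1 - t.1, t.2.1, t.1 + t.2.2 - t.2.1)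
  else (t.1 - 2 * t.2.1, t.1 + t.2.2 - t.2.1, t.2.1)

/-- The positive solutions of `x ^ 2 + 4 * y * z = u`. -/
def zagierSet (u : ℕ) : Finset (ℕ × ℕ × ℕ) :=
  {t ∈ range (u + 1) ×ˢ range (u + 1) ×ˢ range (u + 1) |
    0 < t.1 ∧ 0 < t.2.1 ∧ 0 < t.2.2 ∧ t.1 * t.1 + 4 * (t.2.1 * t.2.2) = u}

theorem mem_zagierSet {u x y z : ℕ} :
    (x, y, z) ∈ zagierSet u ↔ 0 < x ∧ 0 < y ∧ 0 < z ∧ x * x + 4 * (y * z) = u := by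
  simp only [zagierSet, mem_filter, mem_product, mem_range, and_iff_right_iff_imp]
  rintro ⟨hx, hy, hz, h⟩
  refine ⟨?_, ?_, ?_⟩ <;> nlinarith

theorem zagier_mem {u : ℕ} (hu : ¬ IsSquare u) (hu4 : u % 4 = 1) {t : ℕ × ℕ × ℕ}
    (ht : t ∈ zagierSet u) : zagier t ∈ zagierSet u ∧ zagier (zagier t) = t := by
  obtain ⟨x, y, z⟩ := t
  obtain ⟨hx, hy, hz, h⟩ := mem_zagierSet.1 ht
  have h1 : y ≠ x + z := by
    rintro rfl
    exact hu ⟨x + 2 * z, by rw [← h]; ring⟩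
  have h2 : x ≠ 2 * y := by
    rintro rfl
    have : 4 ∣ u := ⟨y * y + y * z, by rw [← h]; ring⟩
    omega
  by_cases c1 : x + z < y
  · obtain ⟨k, rfl⟩ := Nat.exists_eq_add_of_lt c1
    have e : zagier (x, x + z + k + 1, z) = (x + 2 * z, z, k + 1) := by
      simp only [zagier, if_pos c1]
      congr 2; omega
    rw [e]
    refine ⟨mem_zagierSet.2 ⟨by omega, by omega, by omega, by rw [← h]; ring⟩, ?_⟩
    simp only [zagier]
    rw [if_neg (by omega), if_neg (by omega)]
    simp only [Prod.mk.injEq, and_true]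
    omega
  · by_cases c2 : x < 2 * y
    · have e : zagier (x, y, z) = (2 * y - x, y, x + z - y) := by
        simp only [zagier, if_neg c1, if_pos c2]
      rw [e]
      refine ⟨mem_zagierSet.2 ⟨by omega, by omega, by omega, ?_⟩, ?_⟩
      · rw [← h]
        zify [c2.le, not_lt.1 c1]
        ring
      · simp only [zagier]
        rw [if_neg (by omega), if_pos (by omega)]
        simp only [Prod.mk.injEq, true_and]
        omega
    · obtain ⟨k, rfl⟩ := Nat.exists_eq_add_of_le (not_lt.1 c2)
      have e : zagier (2 * y + k, y, z) = (k, y + k + z, y) := by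
        simp only [zagier, if_neg c1, if_neg c2, Prod.mk.injEq, and_true]
        omega
      rw [e]
      refine ⟨mem_zagierSet.2 ⟨by omega, by omega, by omega, by rw [← h]; ring⟩, ?_⟩
      simp only [zagier]
      rw [if_pos (by omega)]
      simp only [Prod.mk.injEq, true_and]
      omega

theorem zagier_eq_self_iff {x y z : ℕ} (hx : 0 < x) (hy : 0 < y) (hz : 0 < z) :
    zagier (x, y, z) = (x, y, z) ↔ x = y := by
  simp only [zagier]
  split_ifs <;> simp only [Prod.mk.injEq, true_and] <;> omega

theorem card_zagierSet_fixed {u : ℕ} (hu4 : u % 4 = 1) :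
    #{t ∈ zagierSet u | zagier t = t} = #{d ∈ u.divisors | d * d < u} := by
  have h0 : u ≠ 0 := by rintro rfl; simp at hu4
  refine card_nbij' (fun t ↦ t.1) (fun d ↦ (d, d, (u / d - d) / 4)) ?_ ?_ ?_ ?_
  · rintro ⟨x, y, z⟩ ht
    simp only [coe_filter, Set.mem_ofPred_eq, mem_zagierSet, Nat.mem_divisors] at ht ⊢
    obtain ⟨⟨hx, hy, hz, h⟩, hfix⟩ := ht
    obtain rfl := (zagier_eq_self_iff hx hy hz).1 hfix
    refine ⟨⟨⟨x + 4 * z, by rw [← h]; ring⟩, h0⟩, by nlinarith⟩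
  · intro d hd
    simp only [coe_filter, Set.mem_ofPred_eq, mem_zagierSet, Nat.mem_divisors] at hd ⊢
    obtain ⟨⟨⟨e, rfl⟩, _⟩, hlt⟩ := hd
    have hd0 : 0 < d := Nat.pos_of_ne_zero (by rintro rfl; simp at h0)
    have hde : d < e := Nat.lt_of_mul_lt_mul_left hlt
    rw [Nat.mul_div_cancel_left _ hd0]
    have hmod : d % 4 = e % 4 := by
      have h1 : d % 4 < 4 := Nat.mod_lt _ (by norm_num)
      have h2 : e % 4 < 4 := Nat.mod_lt _ (by norm_num)
      rw [Nat.mul_mod] at hu4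
      interval_cases d % 4 <;> interval_cases e % 4 <;> simp_all
    obtain ⟨k, rfl⟩ : ∃ k, e = d + 4 * k := ⟨(e - d) / 4, by omega⟩
    have : (d + 4 * k - d) / 4 = k := by omega
    rw [this]
    exact ⟨⟨hd0, hd0, by omega, by ring⟩, (zagier_eq_self_iff hd0 hd0 (by omega)).2 rfl⟩
  · rintro ⟨x, y, z⟩ ht
    simp only [coe_filter, Set.mem_ofPred_eq, mem_zagierSet] at ht ⊢
    obtain ⟨⟨hx, hy, hz, h⟩, hfix⟩ := ht
    obtain rfl := (zagier_eq_self_iff hx hy hz).1 hfix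
    have : u / x = x + 4 * z := by
      rw [← h, ← Nat.mul_div_cancel_left (x + 4 * z) hx]
      congr 1; ring
    rw [this]
    simp
  · intro d _
    rfl

/-- The number of positive solutions of `a ^ 2 + 4 * b ^ 2 = u`. -/
def sqAddFourSqCount (u : ℕ) : ℕ :=
  #{p ∈ range (u + 1) ×ˢ range (u + 1) | 0 < p.1 ∧ 0 < p.2 ∧ p.1 * p.1 + 4 * (p.2 * p.2) = u}

theorem card_zagierSet_swap_fixed (u : ℕ) :
    #{t ∈ zagierSet u | (t.1, t.2.2, t.2.1) = t} = sqAddFourSqCount u := by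
  refine card_nbij' (fun t ↦ (t.1, t.2.1)) (fun p ↦ (p.1, p.2, p.2)) ?_ ?_ ?_ ?_
  · rintro ⟨x, y, z⟩ ht
    simp only [coe_filter, Set.mem_ofPred_eq, mem_zagierSet, mem_product, mem_range,
      Prod.mk.injEq] at ht ⊢
    obtain ⟨⟨hx, hy, hz, h⟩, -, rfl, -⟩ := ht
    exact ⟨⟨by nlinarith, by nlinarith⟩, hx, hy, h⟩
  · rintro ⟨a, b⟩ hp
    simp only [coe_filter, Set.mem_ofPred_eq, mem_zagierSet, and_true] at hp ⊢
    exact ⟨hp.2.1, hp.2.2.1, hp.2.2.1, hp.2.2.2⟩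
  · rintro ⟨x, y, z⟩ ht
    simp only [coe_filter, Set.mem_ofPred_eq, Prod.mk.injEq] at ht ⊢
    exact ⟨trivial, trivial, ht.2.2.2⟩
  · intro p _
    rfl

theorem card_divisors_mod_four {u : ℕ} (hu : ¬ IsSquare u) (hu4 : u % 4 = 1) :
    #u.divisors % 4 = 2 * sqAddFourSqCount u % 4 := by
  have h1 := card_mod_two_eq_card_fixed (zagierSet u) zagier
    (fun t ht ↦ (zagier_mem hu hu4 ht).1) (fun t ht ↦ (zagier_mem hu hu4 ht).2)
  have h2 := card_mod_two_eq_card_fixed (zagierSet u) (fun t ↦ (t.1, t.2.2, t.2.1))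
    (by
      rintro ⟨x, y, z⟩ ht
      obtain ⟨hx, hy, hz, h⟩ := mem_zagierSet.1 ht
      exact mem_zagierSet.2 ⟨hx, hz, hy, by rw [← h]; ring⟩)
    (fun t _ ↦ rfl)
  rw [card_zagierSet_fixed hu4] at h1
  rw [card_zagierSet_swap_fixed] at h2
  rw [card_divisors_eq_two_mul hu]
  omega

/-- The quadruples of positive integers `(a, b, c, d)` with `a * b + c * d = n`. -/
def quadruples (n : ℕ) : Finset (ℕ × ℕ × ℕ × ℕ) :=
  {q ∈ range (n + 1) ×ˢ range (n + 1) ×ˢ range (n + 1) ×ˢ range (n + 1) |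
    0 < q.1 ∧ 0 < q.2.1 ∧ 0 < q.2.2.1 ∧ 0 < q.2.2.2 ∧ q.1 * q.2.1 + q.2.2.1 * q.2.2.2 = n}

theorem mem_quadruples {n a b c d : ℕ} :
    (a, b, c, d) ∈ quadruples n ↔
      0 < a ∧ 0 < b ∧ 0 < c ∧ 0 < d ∧ a * b + c * d = n := by
  simp only [quadruples, mem_filter, mem_product, mem_range, and_iff_right_iff_imp]
  rintro ⟨ha, hb, hc, hd, h⟩
  refine ⟨?_, ?_, ?_, ?_⟩ <;> nlinarith

theorem card_quadruples (n : ℕ) :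
    #(quadruples n) = ∑ p ∈ antidiagonal n, #p.1.divisors * #p.2.divisors := by
  rw [card_eq_sum_card_fiberwise (f := fun q ↦ (q.1 * q.2.1, q.2.2.1 * q.2.2.2))
    (t := antidiagonal n)]
  · refine sum_congr rfl ?_
    rintro ⟨i, j⟩ hij
    rw [← card_product]
    have hij := mem_antidiagonal.1 hij
    refine card_nbij' (fun q ↦ (q.1, q.2.2.1)) (fun p ↦ (p.1, i / p.1, p.2, j / p.2)) ?_ ?_ ?_ ?_
    · rintro ⟨a, b, c, d⟩ hq
      simp only [coe_filter, Set.mem_ofPred_eq, mem_quadruples, Prod.mk.injEq, mem_coe,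
        mem_product, Nat.mem_divisors] at hq ⊢
      obtain ⟨⟨ha, hb, hc, hd, -⟩, rfl, rfl⟩ := hq
      refine ⟨⟨dvd_mul_right _ _, by positivity⟩, ⟨dvd_mul_right _ _, by positivity⟩⟩
    · rintro ⟨a, c⟩ hp
      simp only [coe_filter, Set.mem_ofPred_eq, mem_quadruples, Prod.mk.injEq, mem_coe,
        mem_product, Nat.mem_divisors] at hp ⊢
      obtain ⟨⟨h1, h2⟩, ⟨h3, h4⟩⟩ := hp
      rw [Nat.mul_div_cancel' h1, Nat.mul_div_cancel' h3]
      have h2 := Nat.pos_of_ne_zero h2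
      have h4 := Nat.pos_of_ne_zero h4
      exact ⟨⟨Nat.pos_of_dvd_of_pos h1 h2, Nat.div_pos (Nat.le_of_dvd h2 h1)
        (Nat.pos_of_dvd_of_pos h1 h2), Nat.pos_of_dvd_of_pos h3 h4,
        Nat.div_pos (Nat.le_of_dvd h4 h3) (Nat.pos_of_dvd_of_pos h3 h4), hij⟩, rfl, rfl⟩
    · rintro ⟨a, b, c, d⟩ hq
      simp only [coe_filter, Set.mem_ofPred_eq, mem_quadruples, Prod.mk.injEq] at hq ⊢
      obtain ⟨⟨ha, hb, hc, hd, -⟩, rfl, rfl⟩ := hq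
      simp [Nat.mul_div_cancel_left _ ha, Nat.mul_div_cancel_left _ hc]
    · intro p _
      rfl
  · rintro ⟨a, b, c, d⟩ hq
    simpa using (mem_quadruples.1 hq).2.2.2.2

theorem card_quadruples_eq_add (n : ℕ) :
    #{q ∈ quadruples n | q.1 = q.2.2.1} + #n.divisors = ∑ d ∈ n.divisors, d := by
  rw [← Nat.sum_div_divisors n fun d ↦ d, card_eq_sum_ones n.divisors,
    card_eq_sum_card_fiberwise (f := fun q ↦ q.1) (t := n.divisors), ← sum_add_distrib]
  · refine sum_congr rfl fun l hl ↦ ?_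
    obtain ⟨⟨m, rfl⟩, h0⟩ := Nat.mem_divisors.1 hl
    have hl0 : 0 < l := Nat.pos_of_ne_zero (by rintro rfl; simp at h0)
    have hm0 : 0 < m := Nat.pos_of_ne_zero (by rintro rfl; simp at h0)
    rw [Nat.mul_div_cancel_left _ hl0]
    suffices h : #{q ∈ quadruples (l * m) | q.1 = q.2.2.1 ∧ q.1 = l} = #(Ioo 0 m) by
      rw [filter_filter, h, Nat.card_Ioo]
      omega
    refine card_nbij' (fun q ↦ q.2.1) (fun b ↦ (l, b, l, m - b)) ?_ ?_ ?_ ?_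
    · rintro ⟨a, b, c, d⟩ hq
      simp only [coe_filter, Set.mem_ofPred_eq, mem_quadruples, mem_coe, mem_Ioo] at hq ⊢
      obtain ⟨⟨ha, hb, hc, hd, h⟩, rfl, rfl⟩ := hq
      rw [← mul_add] at h
      have := Nat.eq_of_mul_eq_mul_left ha h
      omega
    · intro b hb
      simp only [coe_filter, Set.mem_ofPred_eq, mem_quadruples, mem_coe, mem_Ioo] at hb ⊢
      refine ⟨⟨hl0, hb.1, hl0, by omega, ?_⟩, trivial, trivial⟩
      rw [← mul_add]
      congr 1; omega
    · rintro ⟨a, b, c, d⟩ hq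
      simp only [coe_filter, Set.mem_ofPred_eq, mem_quadruples, Prod.mk.injEq] at hq ⊢
      obtain ⟨⟨ha, hb, hc, hd, h⟩, rfl, rfl⟩ := hq
      rw [← mul_add] at h
      have := Nat.eq_of_mul_eq_mul_left ha h
      exact ⟨rfl, trivial, rfl, by omega⟩
    · intro b _
      rfl
  · rintro ⟨a, b, c, d⟩ hq
    simp only [coe_filter, Set.mem_ofPred_eq, mem_quadruples, mem_coe, Nat.mem_divisors] at hq ⊢
    obtain ⟨⟨ha, hb, hc, hd, h⟩, rfl⟩ := hq
    exact ⟨⟨b + d, by rw [← h]; ring⟩, by rw [← h]; positivity⟩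

theorem nu2_eq_card (n : ℕ) : nu2 n = #{q ∈ quadruples n | q.2.2.1 < q.1} := by
  rw [nu2, ← Set.ncard_coe_finset]
  congr 1
  ext ⟨a, b, c, d⟩
  simp only [coe_filter, Set.mem_ofPred_eq, mem_quadruples]
  constructor
  · rintro ⟨h1, h2, h3, h4, h5⟩
    exact ⟨⟨by omega, h3, h2, h4, h5⟩, h1⟩
  · rintro ⟨⟨-, h3, h2, h4, h5⟩, h1⟩
    exact ⟨h1, h2, h3, h4, h5⟩

theorem two_mul_nu2_add (n : ℕ) :
    2 * nu2 n + ∑ d ∈ n.divisors, d =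
      ∑ p ∈ antidiagonal n, #p.1.divisors * #p.2.divisors + #n.divisors := by
  have hswap : #{q ∈ quadruples n | q.2.2.1 < q.1} = #{q ∈ quadruples n | q.1 < q.2.2.1} := by
    refine card_nbij' (fun q ↦ (q.2.2.1, q.2.2.2, q.1, q.2.1))
      (fun q ↦ (q.2.2.1, q.2.2.2, q.1, q.2.1)) ?_ ?_ (fun _ _ ↦ rfl) (fun _ _ ↦ rfl)
    all_goals
      rintro ⟨a, b, c, d⟩ hq
      simp only [coe_filter, Set.mem_ofPred_eq, mem_quadruples] at hq ⊢
      obtain ⟨⟨ha, hb, hc, hd, h⟩, hlt⟩ := hq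
      exact ⟨⟨hc, hd, ha, hb, by rw [← h, add_comm]⟩, hlt⟩
  have hsplit := card_filter_add_card_filter_not (s := quadruples n) (fun q ↦ q.1 = q.2.2.1)
  have hne : #{q ∈ quadruples n | ¬ q.1 = q.2.2.1} =
      #{q ∈ quadruples n | q.2.2.1 < q.1} + #{q ∈ quadruples n | q.1 < q.2.2.1} := by
    rw [← card_union_of_disjoint, ← filter_or]
    · congr 1
      ext q
      rw [mem_filter, mem_filter, and_congr_right_iff]
      omega
    · rw [disjoint_filter]
      intro q _ h1 h2
      omega
  have := card_quadruples_eq_add n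
  rw [nu2_eq_card, ← card_quadruples]
  omega

theorem sum_antidiagonal_two_mul (m : ℕ) (g : ℕ × ℕ → ℕ) :
    ∑ p ∈ antidiagonal (2 * m), g p =
      ∑ p ∈ antidiagonal (2 * m) with p.1 < p.2, (g p + g p.swap) + g (m, m) := by
  have hswap : ∑ p ∈ antidiagonal (2 * m) with p.1 < p.2, g p.swap =
      ∑ p ∈ antidiagonal (2 * m) with p.2 < p.1, g p := by
    refine sum_nbij' Prod.swap Prod.swap ?_ ?_ (fun _ _ ↦ rfl) (fun _ _ ↦ rfl) (fun _ _ ↦ rfl)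
    all_goals
      rintro ⟨i, j⟩ h
      simp only [mem_filter, HasAntidiagonal.mem_antidiagonal, Prod.swap] at h ⊢
      omega
  have heq : {p ∈ antidiagonal (2 * m) | ¬ p.1 < p.2 ∧ ¬ p.2 < p.1} = {(m, m)} := by
    ext ⟨i, j⟩
    simp only [mem_filter, HasAntidiagonal.mem_antidiagonal, mem_singleton, Prod.mk.injEq]
    omega
  have hgt : {p ∈ antidiagonal (2 * m) | ¬ p.1 < p.2 ∧ p.2 < p.1} =
      {p ∈ antidiagonal (2 * m) | p.2 < p.1} := by
    ext ⟨i, j⟩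
    rw [mem_filter, mem_filter, and_congr_right_iff]
    omega
  rw [sum_add_distrib, hswap, ← sum_filter_add_sum_filter_not _ (fun p ↦ p.1 < p.2),
    ← sum_filter_add_sum_filter_not {p ∈ antidiagonal (2 * m) | ¬ p.1 < p.2} (fun p ↦ p.2 < p.1),
    filter_filter, filter_filter, heq, hgt, sum_singleton, add_assoc]

theorem eight_dvd_sum_divisors {m : ℕ} (hm : m % 8 = 7) : 8 ∣ ∑ d ∈ m.divisors, d := by
  rw [← ZMod.natCast_eq_zero_iff, Nat.cast_sum]
  have key : ∀ d ∈ m.divisors, (d : ZMod 8) + ((m / d : ℕ) : ZMod 8) = 0 ∧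
      (d : ZMod 8) ≠ ((m / d : ℕ) : ZMod 8) := by
    intro d hd
    have h : (d : ZMod 8) * ((m / d : ℕ) : ZMod 8) = 7 := by
      rw [← Nat.cast_mul, Nat.mul_div_cancel' (Nat.dvd_of_mem_divisors hd), ← ZMod.natCast_mod, hm]
      rfl
    revert h
    generalize (d : ZMod 8) = x
    generalize ((m / d : ℕ) : ZMod 8) = y
    revert x y
    decide
  refine sum_involution (fun d _ ↦ m / d) (fun d hd ↦ (key d hd).1) ?_ ?_ ?_
  · intro d hd _ h
    exact (key d hd).2 (by rw [h])
  · intro d hd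
    exact Nat.mem_divisors.2 ⟨Nat.div_dvd_of_dvd (Nat.dvd_of_mem_divisors hd), by omega⟩
  · intro d hd
    exact Nat.div_div_self (Nat.dvd_of_mem_divisors hd) (by omega)

theorem card_divisors_mul_self_mod_two {x : ℕ} (hx : 0 < x) : #(x * x).divisors % 2 = 1 := by
  have h0 : x * x ≠ 0 := by positivity
  rw [card_mod_two_eq_card_fixed _ (fun d ↦ x * x / d)]
  · have : {d ∈ (x * x).divisors | x * x / d = d} = {x} := by
      ext d
      simp only [mem_filter, Nat.mem_divisors, mem_singleton]
      constructor
      · rintro ⟨⟨hd, -⟩, h⟩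
        have := Nat.mul_div_cancel' hd
        rw [h] at this
        exact Nat.mul_self_inj.1 this
      · rintro rfl
        exact ⟨⟨dvd_mul_right _ _, h0⟩, Nat.mul_div_cancel_left _ hx⟩
    rw [this, card_singleton]
  · intro d hd
    exact Nat.mem_divisors.2 ⟨Nat.div_dvd_of_dvd (Nat.dvd_of_mem_divisors hd), h0⟩
  · intro d hd
    exact Nat.div_div_self (Nat.dvd_of_mem_divisors hd) h0

theorem mul_self_mod_sixteen (x : ℕ) :
    x % 4 = 0 ∧ x * x % 16 = 0 ∨ x % 4 = 2 ∧ x * x % 16 = 4 ∨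
      x % 2 = 1 ∧ (x * x % 16 = 1 ∨ x * x % 16 = 9) := by
  have h : x % 16 < 16 := Nat.mod_lt _ (by norm_num)
  rw [Nat.mul_mod]
  have h4 : x % 4 = x % 16 % 4 := by omega
  have h2 : x % 2 = x % 16 % 2 := by omega
  rw [h4, h2]
  generalize x % 16 = y at h ⊢
  interval_cases y <;> decide

theorem mod_eight_of_isSquare {u : ℕ} (hu : IsSquare u) : u % 8 = 0 ∨ u % 8 = 1 ∨ u % 8 = 4 := by
  obtain ⟨x, rfl⟩ := hu
  have := mul_self_mod_sixteen x
  omega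

theorem card_divisors_two_mul {m : ℕ} (hm : m % 2 = 1) :
    #(2 * m).divisors = 2 * #m.divisors := by
  rw [Nat.Coprime.card_divisors_mul (Nat.coprime_two_left.2 (Nat.odd_iff.2 hm))]
  rfl

theorem sum_divisors_two_mul {m : ℕ} (hm : m % 2 = 1) :
    ∑ d ∈ (2 * m).divisors, d = 3 * ∑ d ∈ m.divisors, d := by
  rw [Nat.Coprime.sum_divisors_mul (Nat.coprime_two_left.2 (Nat.odd_iff.2 hm))]
  rfl

theorem card_divisors_mod_two {u : ℕ} (hu : ¬ IsSquare u) : #u.divisors % 2 = 0 := by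
  rw [card_divisors_eq_two_mul hu]
  omega

theorem four_dvd_card_divisors_two_mul {m : ℕ} (h : m % 8 = 5 ∨ m % 8 = 7) :
    4 ∣ #(2 * m).divisors := by
  have hsq : ¬ IsSquare m := fun hs ↦ by have := mod_eight_of_isSquare hs; omega
  rw [card_divisors_two_mul (by omega)]
  have := card_divisors_mod_two hsq
  omega

/-- The positive solutions of `x ^ 2 + a ^ 2 + 4 * b ^ 2 = n` with `x` odd. -/
def oddSqTriples (n : ℕ) : Finset (ℕ × ℕ × ℕ) :=
  {t ∈ range (n + 1) ×ˢ range (n + 1) ×ˢ range (n + 1) |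
    t.1 % 2 = 1 ∧ 0 < t.2.1 ∧ 0 < t.2.2 ∧ t.1 * t.1 + t.2.1 * t.2.1 + 4 * (t.2.2 * t.2.2) = n}

theorem mem_oddSqTriples {n x a b : ℕ} :
    (x, a, b) ∈ oddSqTriples n ↔
      x % 2 = 1 ∧ 0 < a ∧ 0 < b ∧ x * x + a * a + 4 * (b * b) = n := by
  simp only [oddSqTriples, mem_filter, mem_product, mem_range, and_iff_right_iff_imp]
  rintro ⟨hx, ha, hb, h⟩
  refine ⟨?_, ?_, ?_⟩ <;> nlinarith

theorem card_oddSqTriples (n : ℕ) :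
    #(oddSqTriples n) = ∑ x ∈ range (n + 1) with x % 2 = 1, sqAddFourSqCount (n - x * x) := by
  rw [card_eq_sum_card_fiberwise (f := fun t ↦ t.1) (t := {x ∈ range (n + 1) | x % 2 = 1})]
  · refine sum_congr rfl fun x hx ↦ ?_
    have hx2 := (mem_filter.1 hx).2
    refine card_nbij' (fun t ↦ t.2) (fun p ↦ (x, p)) ?_ ?_ ?_ ?_
    · rintro ⟨y, a, b⟩ ht
      simp only [coe_filter, Set.mem_ofPred_eq, mem_oddSqTriples, mem_product, mem_range] at ht ⊢
      obtain ⟨⟨-, ha, hb, h⟩, rfl⟩ := ht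
      have h : a * a + 4 * (b * b) = n - y * y := by omega
      exact ⟨⟨by nlinarith, by nlinarith⟩, ha, hb, h⟩
    · rintro ⟨a, b⟩ hp
      simp only [coe_filter, Set.mem_ofPred_eq, mem_oddSqTriples, and_true] at hp ⊢
      obtain ⟨-, ha, hb, h⟩ := hp
      have : 0 < a * a := by positivity
      exact ⟨hx2, ha, hb, by omega⟩
    · rintro ⟨y, a, b⟩ ht
      simp only [coe_filter, Set.mem_ofPred_eq] at ht
      rw [ht.2]
    · intro p _
      rfl
  · rintro ⟨x, a, b⟩ ht
    obtain ⟨hx, -, -, h⟩ := mem_oddSqTriples.1 ht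
    simp only [coe_filter, Set.mem_ofPred_eq, mem_range]
    exact ⟨by nlinarith, hx⟩

theorem card_oddSqTriples_mod_two {m : ℕ} (hm : m % 8 = 7) :
    #(oddSqTriples (2 * m)) % 2 = 0 := by
  rw [card_mod_two_eq_card_fixed _ (fun t ↦ (t.2.1, t.1, t.2.2))]
  · rw [filter_eq_empty_iff.2, card_empty]
    rintro ⟨x, a, b⟩ ht h
    obtain ⟨hx, -, -, h'⟩ := mem_oddSqTriples.1 ht
    obtain rfl : a = x := (Prod.mk.inj h).1
    have h1 := mul_self_mod_sixteen a
    have h2 := mul_self_mod_sixteen b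
    omega
  · rintro ⟨x, a, b⟩ ht
    obtain ⟨hx, ha, hb, h⟩ := mem_oddSqTriples.1 ht
    have h1 := mul_self_mod_sixteen x
    have h2 := mul_self_mod_sixteen a
    have ha2 : a % 2 = 1 := by omega
    exact mem_oddSqTriples.2 ⟨ha2, Nat.pos_of_ne_zero (by rintro rfl; simp at hx), hb,
      by rw [← h, add_comm (x * x)]⟩
  · intro t _
    rfl

theorem sum_isSquare_antidiagonal (n : ℕ) (f : ℕ → ℕ) (hf : f 0 = 0) :
    ∑ p ∈ antidiagonal n, (if IsSquare p.1 then f p.2 else 0) =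
      ∑ x ∈ range (n + 1), f (n - x * x) := by
  rw [Nat.sum_antidiagonal_eq_sum_range_succ_mk, ← sum_filter]
  have h : ∑ x ∈ range (n + 1) with x * x ≤ n, f (n - x * x) =
      ∑ x ∈ range (n + 1), f (n - x * x) := by
    refine sum_filter_of_ne fun x _ hx ↦ ?_
    by_contra hlt
    rw [Nat.sub_eq_zero_of_le (by omega)] at hx
    exact hx hf
  rw [← h]
  symm
  refine sum_nbij (fun x ↦ x * x) ?_ ?_ ?_ (fun _ _ ↦ rfl)
  · intro x hx
    simp only [mem_filter, mem_range] at hx ⊢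
    exact ⟨by omega, x, rfl⟩
  · intro x _ y _ hxy
    exact Nat.mul_self_inj.1 hxy
  · intro k hk
    simp only [coe_filter, mem_range, Set.mem_ofPred_eq, Set.mem_image] at hk ⊢
    obtain ⟨hk, x, rfl⟩ := hk
    exact ⟨x, ⟨by nlinarith, by omega⟩, rfl⟩

theorem sum_card_divisors_sub_mul_self_mod_four {m : ℕ} (hm : m % 8 = 7) :
    (∑ x ∈ range (2 * m + 1), #(2 * m - x * x).divisors) % 4 = 0 := by
  have h : (∑ x ∈ range (2 * m + 1), #(2 * m - x * x).divisors) % 4 =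
      (∑ x ∈ range (2 * m + 1),
        if x % 2 = 1 then 2 * sqAddFourSqCount (2 * m - x * x) else 0) % 4 := by
    rw [sum_nat_mod, sum_nat_mod _ _ fun x ↦ ite _ _ _]
    congr 1
    refine sum_congr rfl fun x _ ↦ ?_
    have hx := mul_self_mod_sixteen x
    rcases le_or_gt (2 * m) (x * x) with hle | hlt
    · rw [Nat.sub_eq_zero_of_le hle]
      have : sqAddFourSqCount 0 = 0 := by decide
      simp [this]
    · split_ifs with hodd
      · refine card_divisors_mod_four (fun hs ↦ ?_) (by omega)
        have := mod_eight_of_isSquare hs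
        omega
      · have he : 2 * m - x * x = 2 * ((2 * m - x * x) / 2) := by omega
        have := four_dvd_card_divisors_two_mul (m := (2 * m - x * x) / 2) (by omega)
        rw [← he] at this
        omega
  rw [h, ← sum_filter, ← mul_sum, ← card_oddSqTriples]
  have := card_oddSqTriples_mod_two hm
  omega

theorem sum_lt_card_divisors_mul_mod_four {m : ℕ} (hm : m % 8 = 7) :
    (∑ p ∈ antidiagonal (2 * m) with p.1 < p.2, #p.1.divisors * #p.2.divisors) % 4 = 0 := by
  have hmsq : ¬ IsSquare m := fun hs ↦ by have := mod_eight_of_isSquare hs; omega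
  rw [← sum_card_divisors_sub_mul_self_mod_four hm,
    ← sum_isSquare_antidiagonal _ (fun k ↦ #k.divisors) (by simp), sum_antidiagonal_two_mul,
    if_neg hmsq, add_zero, sum_nat_mod, sum_nat_mod _ _ fun p ↦ _ + _]
  congr 1
  refine sum_congr rfl ?_
  rintro ⟨i, j⟩ hp
  obtain ⟨hij, hlt⟩ : i + j = 2 * m ∧ i < j := by simpa using hp
  have odd_mul : ∀ a b : ℕ, a % 2 = 1 → b % 2 = 0 → a * b % 4 = b % 4 := by
    intro a b ha hb
    obtain ⟨c, rfl⟩ : ∃ c, a = 2 * c + 1 := ⟨a / 2, by omega⟩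
    obtain ⟨e, rfl⟩ : ∃ e, b = 2 * e := ⟨b / 2, by omega⟩
    rw [show (2 * c + 1) * (2 * e) = 2 * e + 4 * (c * e) by ring]
    omega
  simp only [Prod.swap]
  by_cases hi : IsSquare i <;> by_cases hj : IsSquare j
  · have := mod_eight_of_isSquare hi
    have := mod_eight_of_isSquare hj
    omega
  · rw [if_pos hi, if_neg hj, add_zero]
    rcases Nat.eq_zero_or_pos i with rfl | hi0
    · obtain rfl : j = 2 * m := by omega
      have := four_dvd_card_divisors_two_mul (m := m) (by omega)
      simp
      omega
    · obtain ⟨x, rfl⟩ := hi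
      exact odd_mul _ _ (card_divisors_mul_self_mod_two (Nat.pos_of_mul_pos_left hi0))
        (card_divisors_mod_two hj)
  · rw [if_neg hi, if_pos hj, zero_add, mul_comm]
    obtain ⟨x, rfl⟩ := hj
    exact odd_mul _ _ (card_divisors_mul_self_mod_two (Nat.pos_of_ne_zero (by rintro rfl; omega)))
      (card_divisors_mod_two hi)
  · rw [if_neg hi, if_neg hj, card_divisors_eq_two_mul hi, card_divisors_eq_two_mul hj,
      mul_mul_mul_comm]
    omega

theorem nu2_sixteen_n_add_fourteen (n : ℕ) : nu2 (16 * n + 14) % 4 = 0 := by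
  obtain ⟨m, hm, hn⟩ : ∃ m, m % 8 = 7 ∧ 16 * n + 14 = 2 * m := ⟨8 * n + 7, by omega, by ring⟩
  rw [hn]
  have h := two_mul_nu2_add (2 * m)
  have hT := sum_lt_card_divisors_mul_mod_four hm
  have hσ := eight_dvd_sum_divisors hm
  rw [sum_antidiagonal_two_mul, sum_divisors_two_mul (by omega), card_divisors_two_mul (by omega),
    sum_add_distrib] at h
  simp only [Prod.fst_swap, Prod.snd_swap] at h
  rw [sum_congr rfl fun (p : ℕ × ℕ) _ ↦ mul_comm (#p.2.divisors) (#p.1.divisors)] at h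
  have hmsq : ¬ IsSquare m := fun hs ↦ by have := mod_eight_of_isSquare hs; omega
  obtain ⟨e, he⟩ : ∃ e, #m.divisors = 2 * e := ⟨_, card_divisors_eq_two_mul hmsq⟩
  obtain ⟨k, hk⟩ := Nat.even_mul_succ_self e
  rw [he, show 2 * e * (2 * e) = 4 * (e * (e + 1)) - 4 * e by
    rw [eq_tsub_iff_add_eq_of_le (by nlinarith)]; ring] at h
  have : e ≤ e * (e + 1) := by nlinarith
  omega
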